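/- In the general case (Lemma 11 of the paper), assume additionally x_1 < x_2 < ⋯ < x_n. Suppose l* ∈ [1, l] and r* ∈ [r, n] satisfy: r* − l* + 1 ≥ λ + 1; D(l*, r*) = OptCost; r* is the smallest index j ∈ [r, n] with j − l* + 1 ≥ λ minimizing D(l*, j); and l* is the smallest index i ∈ [1, l] with r* − i + 1 ≥ λ minimizing D(i, r*). Then for every i with 1 ≤ i < l*, the index r* is the smallest j ∈ [r, n] with j − i + 1 ≥ λ minimizing D(i, j). -/

import Mathlib

/-- A configuration `y` of the `n` sensors (with covering range `z`) covers the
barrier `[0, β]`. -/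
def Covers (n : ℕ) (z β : ℝ) (y : ℕ → ℝ) : Prop :=
  Set.Icc (0 : ℝ) β ⊆ ⋃ i ∈ Finset.Icc 1 n, Set.Icc (y i - z) (y i + z)

/-- The cost of moving the sensors from positions `x` to positions `y`. -/
noncomputable def Cost (n : ℕ) (x y : ℕ → ℝ) : ℝ :=
  ∑ i ∈ Finset.Icc 1 n, |x i - y i|

/-- The optimal (infimum) cost over all covering configurations. -/
noncomputable def OptCost (n : ℕ) (z β : ℝ) (x : ℕ → ℝ) : ℝ :=
  sInf {c : ℝ | ∃ y : ℕ → ℝ, Covers n z β y ∧ c = Cost n x y}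

/-- General case: the modified positions `x^{(i,j)}` where sensors left of `l` are
moved to `-z` and sensors right of `r` are moved to `β + z`. -/
noncomputable def XMod (x : ℕ → ℝ) (l r : ℕ) (z β : ℝ) (t : ℕ) : ℝ :=
  if t < l then -z else if t ≤ r then x t else β + z

/-- General case: the optimal cost `OptC(i,j)` of the containing-case instance on
sensors `i, …, j` with modified positions `x^{(i,j)}`. -/
noncomputable def OptCG (z β : ℝ) (x : ℕ → ℝ) (l r i j : ℕ) : ℝ :=
  sInf {c : ℝ | ∃ y : ℕ → ℝ,
    (Set.Icc (0 : ℝ) β ⊆ ⋃ t ∈ Finset.Icc i j, Set.Icc (y t - z) (y t + z)) ∧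
    c = ∑ t ∈ Finset.Icc i j, |XMod x l r z β t - y t|}

/-- General case: `D(i,j)`, the cost of the manual movements plus the optimal cost of
the resulting containing-case instance on sensors `i, …, j`. -/
noncomputable def DG (z β : ℝ) (x : ℕ → ℝ) (l r i j : ℕ) : ℝ :=
  (∑ t ∈ Finset.Icc i (l - 1), (-z - x t)) +
    (∑ t ∈ Finset.Icc (r + 1) j, (x t - z - β)) + OptCG z β x l r i j

/-- The sensors `i, …, j` at positions `y` cover `[0, β]` in index order: consecutive
intervals leave no gap, the first one starts at or before `0`, the last one ends at or
after `β`. -/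
structure CoveringChain (z β : ℝ) (i j : ℕ) (y : ℕ → ℝ) : Prop where
  first : y i ≤ z
  last : β - z ≤ y j
  step : ∀ t, i ≤ t → t < j → y (t + 1) ≤ y t + 2 * z

/-- The `t`-th position of the chain in which consecutive intervals just touch and the
`j`-th interval ends at `β`: a lower bound for every chain ending at index `j`. -/
noncomputable def tightPos (z β : ℝ) (j t : ℕ) : ℝ := β - z - 2 * z * ((j : ℝ) - t)

lemma tightPos_succ (z β : ℝ) (j t : ℕ) :
    tightPos z β j (t + 1) = tightPos z β j t + 2 * z := by
  unfold tightPos; push_cast; ring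

lemma tightPos_self (z β : ℝ) (j : ℕ) : tightPos z β j j = β - z := by
  unfold tightPos; ring

lemma tightPos_add_le {z : ℝ} (hz : 0 < z) (β : ℝ) (j : ℕ) {s t : ℕ} (h : s < t) :
    tightPos z β j s + 2 * z ≤ tightPos z β j t := by
  have h' : (s : ℝ) + 1 ≤ t := by exact_mod_cast h
  unfold tightPos
  nlinarith

lemma tightPos_mono {z : ℝ} (hz : 0 < z) (β : ℝ) (j : ℕ) {s t : ℕ} (h : s ≤ t) :
    tightPos z β j s ≤ tightPos z β j t := by
  rcases h.eq_or_lt with rfl | h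
  · rfl
  · linarith [tightPos_add_le hz β j h]

namespace CoveringChain

variable {z β : ℝ} {i j : ℕ} {y : ℕ → ℝ}

lemma tightPos_le (h : CoveringChain z β i j y) {t : ℕ} (hit : i ≤ t) (htj : t ≤ j) :
    tightPos z β j t ≤ y t := by
  induction htj using Nat.decreasingInduction with
  | self => rw [tightPos_self]; exact h.last
  | of_succ k hk ih =>
    have h1 := ih (by omega)
    have h2 := h.step k hit hk
    rw [tightPos_succ] at h1
    linarith

lemma covers (h : CoveringChain z β i j y) (hij : i ≤ j) :
    Set.Icc (0 : ℝ) β ⊆ ⋃ t ∈ Finset.Icc i j, Set.Icc (y t - z) (y t + z) := by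
  rintro p ⟨hp0, hpβ⟩
  simp only [Set.mem_iUnion, Finset.mem_Icc, Set.mem_Icc, exists_prop]
  by_contra! hcon
  have key : ∀ t, i ≤ t → t ≤ j → y t - z ≤ p := by
    intro t hit
    induction t, hit using Nat.le_induction with
    | base => intro _; linarith [h.first]
    | succ k hk ih =>
      intro hkj
      have h1 := hcon k ⟨hk, by omega⟩ (ih (by omega))
      have h2 := h.step k hk (by omega)
      linarith
  have h1 := hcon j ⟨hij, le_rfl⟩ (key j hij le_rfl)
  linarith [h.last]

end CoveringChain

/-- Uncrossing two assignments on the line does not increase the total distance. -/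
lemma abs_sub_add_abs_sub_uncross {a b c d : ℝ} (hab : a ≤ b) (hcd : c ≤ d) :
    |a - c| + |b - d| ≤ |a - d| + |b - c| := by
  rcases abs_cases (a - c) with h1 | h1 <;> rcases abs_cases (b - d) with h2 | h2 <;>
  rcases abs_cases (a - d) with h3 | h3 <;> rcases abs_cases (b - c) with h4 | h4 <;> linarith

/-- Two points moved towards each other with their sum preserved get no farther in
total from any given point. -/
lemma abs_sub_add_abs_sub_squeeze {x b u v : ℝ} (hv : b ≤ v) :
    |x - max u b| + |x - (v + min u b - b)| ≤ |x - u| + |x - v| := by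
  rcases le_total u b with h | h
  · rw [max_eq_right h, min_eq_left h]
    rcases abs_cases (x - b) with h1 | h1 <;> rcases abs_cases (x - (v + u - b)) with h2 | h2 <;>
    rcases abs_cases (x - u) with h3 | h3 <;> rcases abs_cases (x - v) with h4 | h4 <;> linarith
  · rw [max_eq_left h, min_eq_right h]
    simp

lemma abs_sub_max_le {x b u : ℝ} (h : b ≤ x) : |x - max u b| ≤ |x - u| := by
  rcases le_total u b with hu | hu
  · rw [max_eq_right hu, abs_of_nonneg (by linarith), abs_of_nonneg (by linarith)]
    linarith
  · rw [max_eq_left hu]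

lemma abs_sub_min_le {x b u : ℝ} (h : x ≤ b) : |x - min u b| ≤ |x - u| := by
  rcases le_total u b with hu | hu
  · rw [min_eq_left hu]
  · rw [min_eq_right hu, abs_of_nonpos (by linarith), abs_of_nonpos (by linarith)]
    linarith

/-- Reordering targets increasingly does not increase the cost for sorted sources. -/
lemma exists_sorted_cost_le (X : ℕ → ℝ) (i j : ℕ) (hij : i ≤ j)
    (hX : MonotoneOn X (Set.Icc i j)) (y : ℕ → ℝ) :
    ∃ w : ℕ → ℝ, MonotoneOn w (Set.Icc i j) ∧
      (Finset.Icc i j).image w = (Finset.Icc i j).image y ∧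
      ∑ t ∈ Finset.Icc i j, |X t - w t| ≤ ∑ t ∈ Finset.Icc i j, |X t - y t| := by
  induction hij using Nat.decreasingInduction generalizing y with
  | self => exact ⟨y, by simp, rfl, le_rfl⟩
  | of_succ k hk ih =>
    have hsplit : Finset.Icc k j = insert k (Finset.Icc (k + 1) j) := by
      ext t; simp only [Finset.mem_Icc, Finset.mem_insert]; omega
    have hnot : k ∉ Finset.Icc (k + 1) j := by simp
    obtain ⟨m, hm, hmin⟩ := Finset.exists_min_image (Finset.Icc k j) y
      ⟨k, Finset.mem_Icc.2 ⟨le_rfl, hk.le⟩⟩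
    have hmI := Finset.mem_Icc.1 hm
    have hkI : k ∈ Finset.Icc k j := Finset.mem_Icc.2 ⟨le_rfl, hk.le⟩
    obtain ⟨v, hvk, hvim, hvcost⟩ : ∃ v : ℕ → ℝ, v k = y m ∧
        (Finset.Icc k j).image v = (Finset.Icc k j).image y ∧
        ∑ t ∈ Finset.Icc k j, |X t - v t| ≤ ∑ t ∈ Finset.Icc k j, |X t - y t| := by
      refine ⟨fun t => y (Equiv.swap k m t), by simp, ?_, ?_⟩
      · have hmem : ∀ t ∈ Finset.Icc k j, Equiv.swap k m t ∈ Finset.Icc k j := by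
          intro t ht
          rw [Equiv.swap_apply_def]
          split_ifs <;> assumption
        ext a
        simp only [Finset.mem_image]
        constructor
        · rintro ⟨t, ht, rfl⟩
          exact ⟨_, hmem t ht, rfl⟩
        · rintro ⟨t, ht, rfl⟩
          exact ⟨_, hmem t ht, by simp⟩
      · rcases eq_or_ne k m with rfl | hne
        · simp
        have hm' : m ∈ (Finset.Icc k j).erase k := Finset.mem_erase.2 ⟨hne.symm, hm⟩
        rw [← Finset.add_sum_erase _ _ hkI, ← Finset.add_sum_erase _ _ hm',
          ← Finset.add_sum_erase _ (fun t => |X t - y t|) hkI,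
          ← Finset.add_sum_erase _ (fun t => |X t - y t|) hm']
        have hrest : ∑ t ∈ ((Finset.Icc k j).erase k).erase m, |X t - y (Equiv.swap k m t)| =
            ∑ t ∈ ((Finset.Icc k j).erase k).erase m, |X t - y t| := by
          refine Finset.sum_congr rfl fun t ht => ?_
          simp only [Finset.mem_erase] at ht
          rw [Equiv.swap_apply_of_ne_of_ne ht.2.1 ht.1]
        rw [hrest]
        simp only [Equiv.swap_apply_left, Equiv.swap_apply_right]
        have := abs_sub_add_abs_sub_uncross (hX ⟨le_rfl, hk.le⟩ hmI hmI.1) (hmin k hkI)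
        linarith
    obtain ⟨w, hwmono, hwim, hwcost⟩ := ih (hX.mono (Set.Icc_subset_Icc_left (by omega))) v
    have hcongr : ∀ t ∈ Finset.Icc (k + 1) j, Function.update w k (y m) t = w t := by
      intro t ht
      exact Function.update_of_ne (by rintro rfl; exact hnot ht) _ _
    have himage : (Finset.Icc k j).image (Function.update w k (y m)) =
        (Finset.Icc k j).image y := by
      rw [← hvim, hsplit, Finset.image_insert, Finset.image_insert, Finset.image_congr hcongr,
        hwim, hvk, Function.update_self]
    refine ⟨Function.update w k (y m), ?_, himage, ?_⟩
    · intro s hs t ht hst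
      rcases hs.1.eq_or_lt with rfl | hs'
      · rw [Function.update_self]
        have : Function.update w k (y m) t ∈ (Finset.Icc k j).image y := by
          rw [← himage]
          exact Finset.mem_image_of_mem _ (Finset.mem_Icc.2 ht)
        obtain ⟨a, ha, hat⟩ := Finset.mem_image.1 this
        rw [← hat]
        exact hmin a ha
      · rw [hcongr s (Finset.mem_Icc.2 ⟨hs', hs.2⟩),
          hcongr t (Finset.mem_Icc.2 ⟨hs'.trans_le hst, ht.2⟩)]
        exact hwmono ⟨hs', hs.2⟩ ⟨hs'.trans_le hst, ht.2⟩ hst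
    · refine le_trans ?_ hvcost
      rw [hsplit, Finset.sum_insert hnot, Finset.sum_insert hnot, Function.update_self, hvk,
        Finset.sum_congr rfl fun t ht => by rw [hcongr t ht]]
      linarith

/-- When all sources are sorted and meet the barrier, every covering configuration can be
replaced by a chain at no extra cost. -/
lemma exists_coveringChain_cost_le {z β : ℝ} (hz : 0 < z) (hβ : 0 < β) {X : ℕ → ℝ} {i j : ℕ}
    (hij : i ≤ j) (hX : MonotoneOn X (Set.Icc i j))
    (hXmem : ∀ t ∈ Finset.Icc i j, -z ≤ X t ∧ X t ≤ β + z) {y : ℕ → ℝ}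
    (hy : Set.Icc (0 : ℝ) β ⊆ ⋃ t ∈ Finset.Icc i j, Set.Icc (y t - z) (y t + z)) :
    ∃ w, CoveringChain z β i j w ∧
      ∑ t ∈ Finset.Icc i j, |X t - w t| ≤ ∑ t ∈ Finset.Icc i j, |X t - y t| := by
  obtain ⟨w, hmono, him, hcost⟩ := exists_sorted_cost_le X i j hij hX
    fun t => max (min (y t) (β + z)) (-z)
  have hmem : ∀ t ∈ Finset.Icc i j, -z ≤ w t ∧ w t ≤ β + z := by
    intro t ht
    have : w t ∈ (Finset.Icc i j).image w := Finset.mem_image_of_mem _ ht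
    rw [him] at this
    obtain ⟨s, -, hs⟩ := Finset.mem_image.1 this
    rw [← hs]
    exact ⟨le_max_right _ _, max_le (min_le_right _ _) (by linarith)⟩
  have hcov : ∀ p, 0 ≤ p → p ≤ β → ∃ t ∈ Finset.Icc i j, w t - z ≤ p ∧ p ≤ w t + z := by
    intro p hp0 hpβ
    have := hy ⟨hp0, hpβ⟩
    simp only [Set.mem_iUnion, Set.mem_Icc, exists_prop] at this
    obtain ⟨t, ht, h1, h2⟩ := this
    have hclamp : max (min (y t) (β + z)) (-z) = y t := by
      rw [min_eq_left (by linarith), max_eq_left (by linarith)]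
    have : y t ∈ (Finset.Icc i j).image w := by
      rw [him]
      exact Finset.mem_image.2 ⟨t, ht, hclamp⟩
    obtain ⟨s, hs, hst⟩ := Finset.mem_image.1 this
    exact ⟨s, hs, by linarith, by linarith⟩
  refine ⟨w, ⟨?_, ?_, ?_⟩, hcost.trans (Finset.sum_le_sum fun t ht => ?_)⟩
  · obtain ⟨t, ht, h1, -⟩ := hcov 0 le_rfl hβ.le
    have ht' := Finset.mem_Icc.1 ht
    linarith [hmono ⟨le_rfl, hij⟩ ht' ht'.1]
  · obtain ⟨t, ht, -, h1⟩ := hcov β hβ.le le_rfl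
    have ht' := Finset.mem_Icc.1 ht
    linarith [hmono ht' ⟨hij, le_rfl⟩ ht'.2]
  · intro t hit htj
    by_contra! hgap
    have h1 := (hmem t (Finset.mem_Icc.2 ⟨hit, htj.le⟩)).1
    have h2 := (hmem (t + 1) (Finset.mem_Icc.2 ⟨by omega, htj⟩)).2
    obtain ⟨s, hs, h3, h4⟩ := hcov ((w t + w (t + 1)) / 2) (by linarith) (by linarith)
    have hs' := Finset.mem_Icc.1 hs
    rcases le_or_gt s t with hst | hst
    · linarith [hmono hs' ⟨hit, htj.le⟩ hst]
    · linarith [hmono ⟨by omega, htj⟩ hs' hst]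
  · exact (abs_sub_max_le (hXmem t ht).1).trans (abs_sub_min_le (hXmem t ht).2)

/-- The modified positions are sorted and meet the barrier. -/
structure SortedMeeting (z β : ℝ) (x : ℕ → ℝ) (l r : ℕ) : Prop where
  mono : Monotone (XMod x l r z β)
  mem : ∀ t, -z ≤ XMod x l r z β t ∧ XMod x l r z β t ≤ β + z

section OptCG

variable {z β : ℝ} {x : ℕ → ℝ} {l r : ℕ}

lemma XMod_of_lt {t : ℕ} (h : t < l) : XMod x l r z β t = -z := by
  simp [XMod, h]

lemma XMod_of_gt {t : ℕ} (hlr : l ≤ r) (h : r < t) : XMod x l r z β t = β + z := by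
  rw [XMod, if_neg (by omega), if_neg (by omega)]

lemma sortedMeeting_of_monotoneOn (hz : 0 < z) (hβ : 0 < β)
    (hx : MonotoneOn x (Set.Icc l r)) (hl : -z ≤ x l) (hr : x r ≤ β + z) :
    SortedMeeting z β x l r := by
  have hmem : ∀ t, -z ≤ XMod x l r z β t ∧ XMod x l r z β t ≤ β + z := by
    intro t
    unfold XMod
    split_ifs with h1 h2
    · constructor <;> linarith
    · have hlt : l ≤ t := by omega
      have hlr : l ≤ r := hlt.trans h2
      exact ⟨hl.trans (hx ⟨le_rfl, hlr⟩ ⟨hlt, h2⟩ hlt), (hx ⟨hlt, h2⟩ ⟨hlr, le_rfl⟩ h2).trans hr⟩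
    · constructor <;> linarith
  refine ⟨fun s t hst => ?_, hmem⟩
  by_cases hs : s < l
  · rw [XMod_of_lt hs]
    exact (hmem t).1
  by_cases ht : t ≤ r
  · rw [XMod, XMod, if_neg hs, if_pos (hst.trans ht), if_neg (by omega), if_pos ht]
    exact hx ⟨by omega, hst.trans ht⟩ ⟨by omega, ht⟩ hst
  · have : XMod x l r z β t = β + z := by
      rw [XMod, if_neg (by omega), if_neg ht]
    rw [this]
    exact (hmem s).2

lemma OptCG_le_of_coveringChain {i j : ℕ} (hij : i ≤ j) {y : ℕ → ℝ} (hy : CoveringChain z β i j y) :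
    OptCG z β x l r i j ≤ ∑ t ∈ Finset.Icc i j, |XMod x l r z β t - y t| := by
  refine csInf_le ⟨0, ?_⟩ ⟨y, hy.covers hij, rfl⟩
  rintro _ ⟨w, -, rfl⟩
  exact Finset.sum_nonneg fun t _ => abs_nonneg _

lemma exists_coveringChain (hz : 0 < z) {i j : ℕ} (hsize : i + ⌈β / (2 * z)⌉₊ ≤ j + 1) :
    ∃ y, CoveringChain z β i j y := by
  refine ⟨fun t => z + 2 * z * ((t : ℝ) - i), by simp, ?_, fun t _ _ => ?_⟩
  · have h1 : (i : ℝ) + ⌈β / (2 * z)⌉₊ ≤ j + 1 := by exact_mod_cast hsize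
    have h2 : β ≤ ⌈β / (2 * z)⌉₊ * (2 * z) :=
      (div_le_iff₀ (by linarith)).1 (Nat.le_ceil (β / (2 * z)))
    nlinarith
  · push_cast
    linarith

lemma le_OptCG (hz : 0 < z) (hβ : 0 < β) (hX : SortedMeeting z β x l r) {i j : ℕ} (hij : i ≤ j)
    (hsize : i + ⌈β / (2 * z)⌉₊ ≤ j + 1) {K : ℝ}
    (hK : ∀ y, CoveringChain z β i j y → K ≤ ∑ t ∈ Finset.Icc i j, |XMod x l r z β t - y t|) :
    K ≤ OptCG z β x l r i j := by
  obtain ⟨y, hy⟩ := exists_coveringChain hz hsize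
  refine le_csInf ⟨_, y, hy.covers hij, rfl⟩ ?_
  rintro _ ⟨w, hw, rfl⟩
  obtain ⟨v, hv, hvw⟩ := exists_coveringChain_cost_le hz hβ hij (hX.mono.monotoneOn _)
    (fun t _ => hX.mem t) hw
  exact (hK v hv).trans hvw

lemma le_OptCG_add_OptCG (hz : 0 < z) (hβ : 0 < β) (hX : SortedMeeting z β x l r)
    {i j i' j' : ℕ} (hij : i ≤ j) (hij' : i' ≤ j') (hsize : i + ⌈β / (2 * z)⌉₊ ≤ j + 1)
    (hsize' : i' + ⌈β / (2 * z)⌉₊ ≤ j' + 1) {K : ℝ}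
    (hK : ∀ u v, CoveringChain z β i j u → CoveringChain z β i' j' v →
      K ≤ (∑ t ∈ Finset.Icc i j, |XMod x l r z β t - u t|) +
        ∑ t ∈ Finset.Icc i' j', |XMod x l r z β t - v t|) :
    K ≤ OptCG z β x l r i j + OptCG z β x l r i' j' := by
  rw [← sub_le_iff_le_add]
  refine le_OptCG hz hβ hX hij hsize fun u hu => ?_
  rw [sub_le_iff_le_add, ← sub_le_iff_le_add']
  refine le_OptCG hz hβ hX hij' hsize' fun v hv => ?_
  rw [sub_le_iff_le_add']
  exact hK u v hu hv

lemma sum_Icc_eq_sum_Ico_add {M : Type*} [AddCommMonoid M] (f : ℕ → M) {i' i j : ℕ}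
    (h1 : i' ≤ i) (h2 : i ≤ j) :
    ∑ t ∈ Finset.Icc i' j, f t = (∑ t ∈ Finset.Ico i' i, f t) + ∑ t ∈ Finset.Icc i j, f t := by
  simp only [← Finset.Ico_add_one_right_eq_Icc]
  exact (Finset.sum_Ico_consecutive f h1 (by omega)).symm

lemma sum_Icc_eq_add_sum_Ioc {M : Type*} [AddCommMonoid M] (f : ℕ → M) {i j j' : ℕ}
    (h1 : i ≤ j) (h2 : j ≤ j') :
    ∑ t ∈ Finset.Icc i j', f t = (∑ t ∈ Finset.Icc i j, f t) + ∑ t ∈ Finset.Ioc j j', f t := by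
  rw [← Finset.Ico_add_one_right_eq_Icc, ← Finset.Ico_add_one_right_eq_Icc,
    ← Finset.Ico_add_one_add_one_eq_Ioc]
  exact (Finset.sum_Ico_consecutive f (by omega) (by omega)).symm

/-- Replacing a nested pair of index ranges by the crossing pair does not increase the
total optimal cost. -/
lemma OptCG_crossing_le_nested (hz : 0 < z) (hβ : 0 < β) (hX : SortedMeeting z β x l r)
    (hlr : l ≤ r) {i' i j j' : ℕ} (hi : i' ≤ i) (hil : i ≤ l) (hrj : r ≤ j) (hj : j ≤ j')
    (hsize : i + ⌈β / (2 * z)⌉₊ ≤ j + 1) :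
    OptCG z β x l r i' j + OptCG z β x l r i j' ≤
      OptCG z β x l r i' j' + OptCG z β x l r i j := by
  have hij : i ≤ j := by omega
  refine le_OptCG_add_OptCG hz hβ hX (by omega) hij (by omega) hsize fun u v hu hv => ?_
  set b := tightPos z β j with hb
  have hbs : ∀ t, b (t + 1) = b t + 2 * z := tightPos_succ z β j
  have hbj : b j = β - z := tightPos_self z β j
  have hbi : b i ≤ z := (hv.tightPos_le le_rfl hij).trans hv.first
  have hvj := hv.tightPos_le hij le_rfl
  rw [← hb] at hvj
  have hp : CoveringChain z β i' j fun t => max (u t) (b t) := by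
    refine ⟨max_le hu.first ((tightPos_mono hz β j hi).trans hbi), ?_, fun t h1 h2 => ?_⟩
    · rw [hbj]; exact le_max_right _ _
    · rw [hbs, ← max_add_add_right]
      exact max_le_max_right _ (hu.step t h1 (by omega))
  have hminstep : ∀ t, i ≤ t → t < j' →
      min (u (t + 1)) (b (t + 1)) ≤ min (u t) (b t) + 2 * z := by
    intro t h1 h2
    rw [hbs, ← min_add_add_right]
    exact min_le_min_right _ (hu.step t (by omega) h2)
  have hq : CoveringChain z β i j' fun t =>
      if t ≤ j then v t + min (u t) (b t) - b t else min (u t) (b t) := by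
    refine ⟨?_, ?_, fun t h1 h2 => ?_⟩
    · rw [if_pos hij]
      linarith [min_le_right (u i) (b i), hv.first]
    · have hm : β - z ≤ min (u j') (b j') :=
        le_min hu.last (hbj ▸ tightPos_mono hz β j hj)
      split_ifs with h
      · obtain rfl : j' = j := by omega
        linarith
      · exact hm
    · have h3 := hminstep t h1 h2
      rcases lt_trichotomy t j with h | rfl | h
      · rw [if_pos (by omega), if_pos (by omega)]
        linarith [hv.step t h1 h, hbs t]
      · rw [if_neg (by omega), if_pos le_rfl]
        linarith
      · rw [if_neg (by omega), if_neg (by omega)]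
        exact h3
  refine (add_le_add (OptCG_le_of_coveringChain (by omega) hp)
    (OptCG_le_of_coveringChain (by omega) hq)).trans ?_
  rw [sum_Icc_eq_sum_Ico_add _ hi hij, sum_Icc_eq_add_sum_Ioc _ hij hj,
    sum_Icc_eq_sum_Ico_add _ hi (hij.trans hj),
    sum_Icc_eq_add_sum_Ioc (fun t => |XMod x l r z β t - u t|) hij hj]
  have hleft : ∑ t ∈ Finset.Ico i' i, |XMod x l r z β t - max (u t) (b t)| ≤
      ∑ t ∈ Finset.Ico i' i, |XMod x l r z β t - u t| := by
    refine Finset.sum_le_sum fun t ht => abs_sub_max_le ?_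
    rw [Finset.mem_Ico] at ht
    rw [XMod_of_lt (by omega)]
    linarith [tightPos_add_le hz β j ht.2]
  have hmid : (∑ t ∈ Finset.Icc i j, |XMod x l r z β t - max (u t) (b t)|) +
      (∑ t ∈ Finset.Icc i j, |XMod x l r z β t -
        (if t ≤ j then v t + min (u t) (b t) - b t else min (u t) (b t))|) ≤
      (∑ t ∈ Finset.Icc i j, |XMod x l r z β t - u t|) +
        ∑ t ∈ Finset.Icc i j, |XMod x l r z β t - v t| := by
    rw [← Finset.sum_add_distrib, ← Finset.sum_add_distrib]
    refine Finset.sum_le_sum fun t ht => ?_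
    rw [Finset.mem_Icc] at ht
    rw [if_pos ht.2]
    exact abs_sub_add_abs_sub_squeeze (hv.tightPos_le ht.1 ht.2)
  have hright : ∑ t ∈ Finset.Ioc j j', |XMod x l r z β t -
        (if t ≤ j then v t + min (u t) (b t) - b t else min (u t) (b t))| ≤
      ∑ t ∈ Finset.Ioc j j', |XMod x l r z β t - u t| := by
    refine Finset.sum_le_sum fun t ht => ?_
    rw [Finset.mem_Ioc] at ht
    rw [if_neg (by omega)]
    refine abs_sub_min_le ?_
    rw [XMod_of_gt hlr (by omega)]
    linarith [tightPos_add_le hz β j ht.1]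
  linarith

/-- Replacing a crossing pair of index ranges by the nested pair does not increase the
total optimal cost. -/
lemma OptCG_nested_le_crossing (hz : 0 < z) (hβ : 0 < β) (hX : SortedMeeting z β x l r)
    (hlr : l ≤ r) {i' i j j' : ℕ} (hi : i' ≤ i) (hil : i ≤ l) (hrj : r ≤ j) (hj : j ≤ j')
    (hsize : i + ⌈β / (2 * z)⌉₊ ≤ j + 1) :
    OptCG z β x l r i' j' + OptCG z β x l r i j ≤
      OptCG z β x l r i' j + OptCG z β x l r i j' := by
  have hij : i ≤ j := by omega
  refine le_OptCG_add_OptCG hz hβ hX (by omega) (by omega) (by omega) (by omega)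
    fun p q hp hq => ?_
  obtain ⟨v₀, hv₀⟩ := exists_coveringChain hz hsize
  set b := tightPos z β j with hb
  have hbs : ∀ t, b (t + 1) = b t + 2 * z := tightPos_succ z β j
  have hbj : b j = β - z := tightPos_self z β j
  have hbi : b i ≤ z := (hv₀.tightPos_le le_rfl hij).trans hv₀.first
  have hpj := hp.tightPos_le (hi.trans hij) le_rfl
  rw [← hb] at hpj
  have hv : CoveringChain z β i j fun t => max (q t) (b t) := by
    refine ⟨max_le hq.first hbi, ?_, fun t h1 h2 => ?_⟩
    · rw [hbj]; exact le_max_right _ _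
    · rw [hbs, ← max_add_add_right]
      exact max_le_max_right _ (hq.step t h1 (by omega))
  have hminstep : ∀ t, i ≤ t → t < j' →
      min (q (t + 1)) (b (t + 1)) ≤ min (q t) (b t) + 2 * z := by
    intro t h1 h2
    rw [hbs, ← min_add_add_right]
    exact min_le_min_right _ (hq.step t (by omega) h2)
  have hu : CoveringChain z β i' j' fun t =>
      if t < i then p t else if t ≤ j then p t + min (q t) (b t) - b t
        else min (q t) (b t) := by
    refine ⟨?_, ?_, fun t h1 h2 => ?_⟩
    · rw [if_pos (hi.trans hij)]
      split_ifs
      · exact hp.first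
      · linarith [min_le_right (q i') (b i'), hp.first]
    · have hm : β - z ≤ min (q j') (b j') :=
        le_min hq.last (hbj ▸ tightPos_mono hz β j hj)
      rw [if_neg (by omega)]
      split_ifs with h
      · obtain rfl : j' = j := by omega
        linarith
      · exact hm
    · rcases lt_or_ge t i with hti | hti
      · rw [if_pos hti, if_pos (show t + 1 ≤ j by omega)]
        have h3 := hp.step t h1 (by omega)
        split_ifs
        · exact h3
        · linarith [min_le_right (q (t + 1)) (b (t + 1))]
      have h3 := hminstep t hti h2
      rw [if_neg (show ¬ t + 1 < i by omega), if_neg (show ¬ t < i by omega)]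
      rcases lt_trichotomy t j with h | rfl | h
      · rw [if_pos (by omega), if_pos (by omega)]
        linarith [hp.step t h1 h, hbs t]
      · rw [if_neg (by omega), if_pos le_rfl]
        linarith
      · rw [if_neg (by omega), if_neg (by omega)]
        exact h3
  refine (add_le_add (OptCG_le_of_coveringChain (by omega) hu)
    (OptCG_le_of_coveringChain (by omega) hv)).trans ?_
  rw [sum_Icc_eq_sum_Ico_add _ hi (hij.trans hj), sum_Icc_eq_add_sum_Ioc _ hij hj,
    sum_Icc_eq_sum_Ico_add (fun t => |XMod x l r z β t - p t|) hi hij,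
    sum_Icc_eq_add_sum_Ioc (fun t => |XMod x l r z β t - q t|) hij hj]
  have hleft : ∑ t ∈ Finset.Ico i' i, |XMod x l r z β t -
        (if t < i then p t else if t ≤ j then p t + min (q t) (b t) - b t
          else min (q t) (b t))| =
      ∑ t ∈ Finset.Ico i' i, |XMod x l r z β t - p t| := by
    refine Finset.sum_congr rfl fun t ht => ?_
    rw [if_pos (Finset.mem_Ico.1 ht).2]
  have hmid : (∑ t ∈ Finset.Icc i j, |XMod x l r z β t - max (q t) (b t)|) +
      (∑ t ∈ Finset.Icc i j, |XMod x l r z β t -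
        (if t < i then p t else if t ≤ j then p t + min (q t) (b t) - b t
          else min (q t) (b t))|) ≤
      (∑ t ∈ Finset.Icc i j, |XMod x l r z β t - q t|) +
        ∑ t ∈ Finset.Icc i j, |XMod x l r z β t - p t| := by
    rw [← Finset.sum_add_distrib, ← Finset.sum_add_distrib]
    refine Finset.sum_le_sum fun t ht => ?_
    rw [Finset.mem_Icc] at ht
    rw [if_neg (by omega), if_pos ht.2]
    exact abs_sub_add_abs_sub_squeeze (hp.tightPos_le (hi.trans ht.1) ht.2)
  have hright : ∑ t ∈ Finset.Ioc j j', |XMod x l r z β t -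
        (if t < i then p t else if t ≤ j then p t + min (q t) (b t) - b t
          else min (q t) (b t))| ≤
      ∑ t ∈ Finset.Ioc j j', |XMod x l r z β t - q t| := by
    refine Finset.sum_le_sum fun t ht => ?_
    rw [Finset.mem_Ioc] at ht
    rw [if_neg (by omega), if_neg (by omega)]
    refine abs_sub_min_le ?_
    rw [XMod_of_gt hlr (by omega)]
    linarith [tightPos_add_le hz β j ht.1]
  linarith

/-- The optimal cost is convex in the number of sensors supplied from the right. -/
lemma OptCG_convex_right (hz : 0 < z) (hβ : 0 < β) (hX : SortedMeeting z β x l r)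
    (hlr : l ≤ r) {i j : ℕ} (hil : i ≤ l) (hrj : r ≤ j)
    (hsize : i + ⌈β / (2 * z)⌉₊ ≤ j + 1) :
    OptCG z β x l r i (j + 1) + OptCG z β x l r i (j + 1) ≤
      OptCG z β x l r i (j + 2) + OptCG z β x l r i j := by
  have hij : i ≤ j := by omega
  refine le_OptCG_add_OptCG hz hβ hX (by omega) hij (by omega) hsize fun w u hw hu => ?_
  set b := tightPos z β (j + 1) with hb
  have hbs : ∀ t, b (t + 1) = b t + 2 * z := tightPos_succ z β (j + 1)
  have hbj : b (j + 1) = β - z := tightPos_self z β (j + 1)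
  have hbu : ∀ t, i ≤ t → t ≤ j → b t + 2 * z ≤ u t := by
    intro t h1 h2
    have h3 : tightPos z β j t = b t + 2 * z := by
      rw [hb]; unfold tightPos; push_cast; ring
    rw [← h3]
    exact hu.tightPos_le h1 h2
  have hminstep : ∀ t, i ≤ t → t < j + 1 →
      min (w (t + 1)) (b (t + 1)) ≤ min (w t) (b t) + 2 * z := by
    intro t h1 h2
    rw [hbs, ← min_add_add_right]
    exact min_le_min_right _ (hw.step t h1 (by omega))
  have hwj : β - 3 * z ≤ w (j + 1) := by
    have := hw.step (j + 1) (by omega) (by omega)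
    linarith [hw.last]
  have hq : CoveringChain z β i (j + 1) fun t => max (w t) (b t) := by
    refine ⟨max_le hw.first (by linarith [hbu i le_rfl hij, hu.first]), ?_, fun t h1 h2 => ?_⟩
    · rw [hbj]; exact le_max_right _ _
    · rw [hbs, ← max_add_add_right]
      exact max_le_max_right _ (hw.step t h1 (by omega))
  have hp : CoveringChain z β i (j + 1) fun t =>
      (if t ≤ j then u t else β + z) + min (w t) (b t) - b t := by
    refine ⟨?_, ?_, fun t h1 h2 => ?_⟩
    · rw [if_pos hij]
      linarith [min_le_right (w i) (b i), hu.first]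
    · rw [if_neg (by omega), hbj]
      have : β - 3 * z ≤ min (w (j + 1)) (β - z) := le_min hwj (by linarith)
      linarith
    · have h3 := hminstep t h1 h2
      rcases (Nat.lt_succ_iff.1 h2).eq_or_lt with rfl | h
      · rw [if_neg (by omega), if_pos le_rfl]
        linarith [hu.last, hbs t]
      · rw [if_pos (by omega), if_pos (by omega)]
        linarith [hu.step t h1 h, hbs t]
  refine (add_le_add (OptCG_le_of_coveringChain (by omega) hq)
    (OptCG_le_of_coveringChain (by omega) hp)).trans ?_
  rw [Finset.sum_Icc_succ_top (by omega), Finset.sum_Icc_succ_top (by omega),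
    Finset.sum_Icc_succ_top (show i ≤ j + 1 + 1 by omega),
    Finset.sum_Icc_succ_top (show i ≤ j + 1 by omega)]
  have hmid : (∑ t ∈ Finset.Icc i j, |XMod x l r z β t - max (w t) (b t)|) +
      (∑ t ∈ Finset.Icc i j, |XMod x l r z β t -
        ((if t ≤ j then u t else β + z) + min (w t) (b t) - b t)|) ≤
      (∑ t ∈ Finset.Icc i j, |XMod x l r z β t - w t|) +
        ∑ t ∈ Finset.Icc i j, |XMod x l r z β t - u t| := by
    rw [← Finset.sum_add_distrib, ← Finset.sum_add_distrib]
    refine Finset.sum_le_sum fun t ht => ?_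
    rw [Finset.mem_Icc] at ht
    rw [if_pos ht.2]
    exact abs_sub_add_abs_sub_squeeze (by linarith [hbu t ht.1 ht.2])
  have hend := abs_sub_add_abs_sub_squeeze (x := β + z) (b := b (j + 1)) (u := w (j + 1))
    (v := β + z) (by linarith)
  rw [sub_self, abs_zero] at hend
  rw [if_neg (show ¬ j + 1 ≤ j by omega), XMod_of_gt hlr (show r < j + 1 by omega)]
  linarith [abs_nonneg (XMod x l r z β (j + 1 + 1) - w (j + 1 + 1))]

end OptCG

/-- In a sequence with nondecreasing increments, a strict last decrease forces every earlier
term to exceed the final one. -/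
lemma lt_of_convex_of_last_lt {f : ℕ → ℝ} {a m : ℕ} (ham : a ≤ m)
    (hconv : ∀ k, a ≤ k → k < m → f (k + 1) + f (k + 1) ≤ f (k + 2) + f k)
    (hlast : f (m + 1) < f m) : f (m + 1) < f a := by
  have key : f (m + 1) < f a ∧ f (a + 1) < f a := by
    induction ham using Nat.decreasingInduction with
    | self => exact ⟨hlast, hlast⟩
    | of_succ k hk ih =>
      obtain ⟨h1, h2⟩ := ih fun t ht => hconv t (by omega)
      have h3 := hconv k le_rfl hk
      constructor <;> linarith
  exact key.1

/-- Lemma 11: in the general case with strictly increasing input positions, if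
`(l*, r*)` is optimal with `r* − l* + 1 ≥ λ + 1`, `r*` is the smallest minimizer of
`D(l*, ·)` and `l*` is the smallest minimizer of `D(·, r*)` (among indices satisfying
the size constraint `j − i + 1 ≥ λ`), then for every `i < l*`, `r*` is also the
smallest index `j ∈ [r, n]` with `j − i + 1 ≥ λ` minimizing `D(i, j)`. -/
theorem general_row_minimizer_extends_left
    (n : ℕ) (z β : ℝ) (x : ℕ → ℝ) (l r lstar rstar : ℕ)
    (hn : 1 ≤ n) (hz : 0 < z) (hβ : 0 < β)
    (hsort : ∀ i, 1 ≤ i → i < n → x i < x (i + 1))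
    (hfeas : β ≤ 2 * z * n)
    (hl1 : 1 < l) (hrn : r < n) (hlr : l ≤ r)
    (hlmem : -z ≤ x l ∧ x l ≤ β + z)
    (hlmin : ∀ i, 1 ≤ i → i ≤ n → -z ≤ x i → x i ≤ β + z → l ≤ i)
    (hrmem : -z ≤ x r ∧ x r ≤ β + z)
    (hrmax : ∀ i, 1 ≤ i → i ≤ n → -z ≤ x i → x i ≤ β + z → i ≤ r)
    (hls1 : 1 ≤ lstar) (hls2 : lstar ≤ l) (hrs1 : r ≤ rstar) (hrs2 : rstar ≤ n)
    (hsize : lstar + ⌈β / (2 * z)⌉₊ ≤ rstar)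
    (hopt : DG z β x l r lstar rstar = OptCost n z β x)
    (hrowmin : ∀ j, r ≤ j → j ≤ n → lstar + ⌈β / (2 * z)⌉₊ ≤ j + 1 →
      DG z β x l r lstar rstar ≤ DG z β x l r lstar j)
    (hrowleast : ∀ j, r ≤ j → j < rstar → lstar + ⌈β / (2 * z)⌉₊ ≤ j + 1 →
      DG z β x l r lstar rstar < DG z β x l r lstar j)
    (hcolmin : ∀ i, 1 ≤ i → i ≤ l → i + ⌈β / (2 * z)⌉₊ ≤ rstar + 1 →
      DG z β x l r lstar rstar ≤ DG z β x l r i rstar)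
    (hcolleast : ∀ i, 1 ≤ i → i < lstar → i + ⌈β / (2 * z)⌉₊ ≤ rstar + 1 →
      DG z β x l r lstar rstar < DG z β x l r i rstar) :
    ∀ i, 1 ≤ i → i < lstar →
      (∀ j, r ≤ j → j ≤ n → i + ⌈β / (2 * z)⌉₊ ≤ j + 1 →
        DG z β x l r i rstar ≤ DG z β x l r i j) ∧
      (∀ j, r ≤ j → j < rstar → i + ⌈β / (2 * z)⌉₊ ≤ j + 1 →
        DG z β x l r i rstar < DG z β x l r i j) := by
  have hmono : StrictMonoOn x (Set.Icc 1 n) := by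
    refine strictMonoOn_of_lt_add_one Set.ordConnected_Icc fun a _ ha ha' => ?_
    exact hsort a ha.1 ha'.2
  have hX : SortedMeeting z β x l r :=
    sortedMeeting_of_monotoneOn hz hβ
      (hmono.monotoneOn.mono (Set.Icc_subset_Icc hl1.le hrn.le)) hlmem.1 hrmem.2
  intro i hi1 hil
  have hstrict : ∀ j, r ≤ j → j < rstar → i + ⌈β / (2 * z)⌉₊ ≤ j + 1 →
      DG z β x l r i rstar < DG z β x l r i j := by
    intro j hrj hj hsz
    obtain ⟨m, rfl⟩ : ∃ m, rstar = m + 1 := ⟨rstar - 1, by omega⟩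
    refine lt_of_convex_of_last_lt (f := DG z β x l r i) (Nat.lt_succ_iff.1 hj)
      (fun k hk hkm => ?_) ?_
    · have h1 := OptCG_convex_right (i := i) (j := k) hz hβ hX hlr (by omega) (by omega) (by omega)
      have h2 := hsort (k + 1) (by omega) (by omega)
      unfold DG
      rw [Finset.sum_Icc_succ_top (show r + 1 ≤ k + 1 + 1 by omega),
        Finset.sum_Icc_succ_top (show r + 1 ≤ k + 1 by omega)]
      linarith
    · have h1 := hrowleast m (by omega) (by omega) (by omega)
      have h2 := OptCG_nested_le_crossing (i' := i) (i := lstar) (j := m) (j' := m + 1)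
        hz hβ hX hlr hil.le hls2 (by omega) (by omega) (by omega)
      unfold DG at h1 ⊢
      linarith
  refine ⟨fun j hrj hjn hsz => ?_, hstrict⟩
  rcases lt_or_ge j rstar with hj | hj
  · exact (hstrict j hrj hj hsz).le
  · have h1 := hrowmin j hrj hjn (by omega)
    have h2 := OptCG_crossing_le_nested (i' := i) (i := lstar) (j := rstar) (j' := j)
      hz hβ hX hlr hil.le hls2 hrs1 hj (by omega)
    unfold DG at h1 ⊢
    linarith
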